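/- The class of minimally unsatisfiable clause-sets in which every variable has variable-degree at least 3 is stable under singular DP-reduction: if F is minimally unsatisfiable, every variable of F has variable-degree at least 3, and v is a singular variable of F, then DP_v(F) is minimally unsatisfiable and every variable of DP_v(F) has variable-degree at least 3. -/

import Mathlib

/-- A literal: a variable (a natural number) together with a polarity. -/
abbrev Lit : Type := ℕ × Bool

/-- Complementation of literals: a fixed-point-free involution. -/
def Lit.compl (x : Lit) : Lit := (x.1, !x.2)

/-- The set of variables occurring in a clause-set. -/
def varsOf (F : Finset (Finset Lit)) : Finset ℕ := F.biUnion (fun C => C.image Prod.fst)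

/-- The literals over the variables of `F` (both polarities). -/
def litsOf (F : Finset (Finset Lit)) : Finset Lit := varsOf F ×ˢ (Finset.univ : Finset Bool)

/-- A clause is clash-free. -/
def IsClause (C : Finset Lit) : Prop := ∀ x ∈ C, Lit.compl x ∉ C

/-- A clause-set consists of clauses. -/
def IsClauseSet (F : Finset (Finset Lit)) : Prop := ∀ C ∈ F, IsClause C

/-- The truth value of a literal under a total assignment. -/
def LitVal (φ : ℕ → Bool) (x : Lit) : Bool := if x.2 then φ x.1 else !(φ x.1)

/-- Satisfiability of a clause-set. -/
def Sat (F : Finset (Finset Lit)) : Prop := ∃ φ : ℕ → Bool, ∀ C ∈ F, ∃ x ∈ C, LitVal φ x = true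

/-- Minimal unsatisfiability. -/
def MU (F : Finset (Finset Lit)) : Prop := IsClauseSet F ∧ ¬ Sat F ∧ ∀ G ⊂ F, Sat G

/-- Minimally unsatisfiable 2-clause-set. -/
def MU2 (F : Finset (Finset Lit)) : Prop := MU F ∧ ∀ C ∈ F, C.card ≤ 2

/-- The deficiency δ(F) = c(F) - n(F). -/
def deficiency (F : Finset (Finset Lit)) : ℤ := (F.card : ℤ) - ((varsOf F).card : ℤ)

/-- Literal-degree: number of clauses containing the literal. -/
def ldeg (F : Finset (Finset Lit)) (x : Lit) : ℕ := (F.filter (fun C => x ∈ C)).card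

/-- Variable-degree. -/
def vdeg (F : Finset (Finset Lit)) (v : ℕ) : ℕ := ldeg F (v, true) + ldeg F (v, false)

/-- Isomorphism of clause-sets: a bijection between the literals over the variables,
commuting with complementation, mapping one clause-set onto the other. -/
def CNFIso (F F' : Finset (Finset Lit)) (f : Lit → Lit) : Prop :=
  Set.BijOn f ↑(litsOf F) ↑(litsOf F') ∧
  (∀ x ∈ litsOf F, f (Lit.compl x) = Lit.compl (f x)) ∧
  F.image (fun C => C.image f) = F'

/-- A digraph: a finite vertex set and a finite set of arcs. -/
structure FinDigraph (α : Type) where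
  V : Finset α
  E : Finset (α × α)

/-- Well-formedness of a digraph: arcs join distinct vertices. -/
def FinDigraph.WellFormed {α : Type} (G : FinDigraph α) : Prop :=
  ∀ p ∈ G.E, p.1 ∈ G.V ∧ p.2 ∈ G.V ∧ p.1 ≠ p.2

/-- `f` is an isomorphism of digraphs from `G` to `G'`. -/
def DigraphIso {α β : Type} [DecidableEq β] (G : FinDigraph α) (G' : FinDigraph β) (f : α → β) : Prop :=
  Set.BijOn f ↑G.V ↑G'.V ∧ G.E.image (fun p => (f p.1, f p.2)) = G'.E

/-- The implication digraph of a 2-clause-set (without the empty clause):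
vertices are the literals over the variables of `F`, and there is an arc `(a,b)` iff
`{compl a} ∪ {b}` is a clause of `F` (this yields `(x̄,y),(ȳ,x)` for a clause `{x,y}`
and `(x̄,x)` for a unit-clause `{x}`). -/
def idg (F : Finset (Finset Lit)) : FinDigraph Lit :=
  ⟨litsOf F, (litsOf F ×ˢ litsOf F).filter (fun p => insert (Lit.compl p.1) {p.2} ∈ F)⟩

def FinDigraph.inDeg {α : Type} [DecidableEq α] (G : FinDigraph α) (v : α) : ℕ :=
  (G.E.filter (fun p => p.2 = v)).card

def FinDigraph.outDeg {α : Type} [DecidableEq α] (G : FinDigraph α) (v : α) : ℕ :=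
  (G.E.filter (fun p => p.1 = v)).card

/-- The standard double `m`-cycle. -/
def stdDoubleCycle (m : ℕ) : FinDigraph ℕ :=
  ⟨Finset.range m, (Finset.range m).biUnion (fun i => {(i, (i+1) % m), ((i+1) % m, i)})⟩

/-- A double `m`-cycle (`m ≥ 3`). -/
def IsDoubleCycle {α : Type} [DecidableEq α] (m : ℕ) (G : FinDigraph α) : Prop :=
  3 ≤ m ∧ ∃ f : ℕ → α, DigraphIso (stdDoubleCycle m) G f

/-- Splitting a vertex `x` into `u`, `v` with a new arc `(u,v)`:
arcs into `x` now go into `u`, arcs out of `x` now leave `v`. -/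
def SplitVertex {α : Type} [DecidableEq α] (G G' : FinDigraph α) : Prop :=
  ∃ x u v, x ∈ G.V ∧ u ∉ G.V ∧ v ∉ G.V ∧ u ≠ v ∧
    G'.V = insert u (insert v (G.V.erase x)) ∧
    G'.E = insert (u, v)
      ((G.E.filter (fun p => p.1 ≠ x ∧ p.2 ≠ x)) ∪
       ((G.E.filter (fun p => p.2 = x)).image (fun p => (p.1, u))) ∪
       ((G.E.filter (fun p => p.1 = x)).image (fun p => (v, p.2))))

/-- Splitting an arc `(x,y)` by a new (linear) vertex `v`. -/
def SplitArc {α : Type} [DecidableEq α] (G G' : FinDigraph α) : Prop :=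
  ∃ x y v, (x, y) ∈ G.E ∧ v ∉ G.V ∧
    G'.V = insert v G.V ∧
    G'.E = insert (x, v) (insert (v, y) (G.E.erase (x, y)))

/-- An `m`-weak-double-cycle: obtained from a double `m`-cycle by a finite sequence
of vertex splittings and arc splittings. -/
def IsWDC {α : Type} [DecidableEq α] (m : ℕ) (G : FinDigraph α) : Prop :=
  ∃ G₀ : FinDigraph α, IsDoubleCycle m G₀ ∧
    Relation.ReflTransGen (fun A B => SplitVertex A B ∨ SplitArc A B) G₀ G

/-- A digraph is nonlinear if no vertex has in-degree 1 and out-degree 1. -/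
def FinDigraph.Nonlinear {α : Type} [DecidableEq α] (G : FinDigraph α) : Prop :=
  ∀ v ∈ G.V, ¬ (G.inDeg v = 1 ∧ G.outDeg v = 1)

/-- Strong connectivity. -/
def StronglyConnected {α : Type} (G : FinDigraph α) : Prop :=
  ∀ a ∈ G.V, ∀ b ∈ G.V, Relation.ReflTransGen (fun x y => (x, y) ∈ G.E) a b

/-- A cycle digraph: strongly connected, at least 2 vertices, all vertices linear. -/
def IsCycleDigraph {α : Type} [DecidableEq α] (G : FinDigraph α) : Prop :=
  G.WellFormed ∧ 2 ≤ G.V.card ∧ StronglyConnected G ∧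
    ∀ v ∈ G.V, G.inDeg v = 1 ∧ G.outDeg v = 1

/-- A skew-symmetry of a digraph, as a permutation of its vertex set:
a fixed-point-free involution reversing arcs. -/
def IsSkewSym {α : Type} (G : FinDigraph α) (σ : Equiv.Perm {x // x ∈ G.V}) : Prop :=
  (∀ v, σ (σ v) = v) ∧ (∀ v, σ v ≠ v) ∧
  ∀ a b : {x // x ∈ G.V}, ((a : α), (b : α)) ∈ G.E → (((σ b : α)), ((σ a : α))) ∈ G.E

/-- A skew-symmetry has a unit if some vertex is joined by an arc to its image. -/
def HasUnit {α : Type} (G : FinDigraph α) (σ : Equiv.Perm {x // x ∈ G.V}) : Prop :=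
  ∃ v : {x // x ∈ G.V}, ((v : α), ((σ v : α))) ∈ G.E

/-- The literals over the variables of `F` are closed under complementation. -/
lemma compl_mem {F : Finset (Finset Lit)} {x : Lit} (h : x ∈ litsOf F) :
    Lit.compl x ∈ litsOf F := by
  simp only [litsOf, Lit.compl, Finset.mem_product] at h ⊢
  exact ⟨h.1, Finset.mem_univ _⟩

/-- Clause-set isomorphism, as an equivalence between the literals over the variables. -/
def CNFIsoE (F F' : Finset (Finset Lit))
    (e : {x // x ∈ litsOf F} ≃ {x // x ∈ litsOf F'}) : Prop :=
  (∀ x : {x // x ∈ litsOf F}, (e ⟨Lit.compl x.1, compl_mem x.2⟩ : Lit) = Lit.compl (e x : Lit)) ∧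
  F.image (fun C => C.image (fun y =>
      if h : y ∈ litsOf F then ((e ⟨y, h⟩ : {x // x ∈ litsOf F'}) : Lit) else y)) = F'

/-- An automorphism of a digraph, as a permutation of its vertex set preserving arcs. -/
def FinDigraphAut {α : Type} (G : FinDigraph α) (π : Equiv.Perm {x // x ∈ G.V}) : Prop :=
  ∀ a b : {x // x ∈ G.V}, ((a : α), (b : α)) ∈ G.E ↔ ((π a : α), (π b : α)) ∈ G.E

/-- Multiplicity of the edge between `u` and `v` in the underlying multigraph of a digraph. -/
def mult {α : Type} [DecidableEq α] (G : FinDigraph α) (u v : α) : ℕ :=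
  (if (u, v) ∈ G.E then 1 else 0) + (if (v, u) ∈ G.E then 1 else 0)

/-- `f` is an isomorphism between the underlying multigraphs of two digraphs. -/
def MultigraphIso {α β : Type} [DecidableEq α] [DecidableEq β]
    (G : FinDigraph α) (G' : FinDigraph β) (f : α → β) : Prop :=
  Set.BijOn f ↑G.V ↑G'.V ∧ ∀ u ∈ G.V, ∀ v ∈ G.V, mult G u v = mult G' (f u) (f v)

/-- `f` is an isomorphism between the underlying graphs of two digraphs. -/
def GraphIso {α β : Type} (G : FinDigraph α) (G' : FinDigraph β) (f : α → β) : Prop :=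
  Set.BijOn f ↑G.V ↑G'.V ∧ ∀ u ∈ G.V, ∀ v ∈ G.V,
    (((u, v) ∈ G.E ∨ (v, u) ∈ G.E) ↔ ((f u, f v) ∈ G'.E ∨ (f v, f u) ∈ G'.E))

/-- The transpose of a digraph: all arcs reversed. -/
def FinDigraph.transpose {α : Type} [DecidableEq α] (G : FinDigraph α) : FinDigraph α :=
  ⟨G.V, G.E.image (fun p => (p.2, p.1))⟩

/-- DP-reduction on variable `v`: replace all clauses containing `v` or `v̄` by all
their non-tautological resolvents on `v`. -/
def DP (v : ℕ) (F : Finset (Finset Lit)) : Finset (Finset Lit) :=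
  (F.filter (fun C => (v, true) ∉ C ∧ (v, false) ∉ C)) ∪
  ((((F.filter (fun C => (v, true) ∈ C)) ×ˢ (F.filter (fun C => (v, false) ∈ C))).image
      (fun p => (p.1.erase (v, true)) ∪ (p.2.erase (v, false)))).filter
    (fun C => ∀ x ∈ C, Lit.compl x ∉ C))

/-- A variable is singular if one of its literals has literal-degree 1. -/
def Singular (F : Finset (Finset Lit)) (v : ℕ) : Prop :=
  ldeg F (v, true) = 1 ∨ ldeg F (v, false) = 1

/-- The "middle part" `M_n = {{v̄_1,v_2},…,{v̄_{n−1},v_n}}`, with variables `1,…,n`. -/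
def Mn (n : ℕ) : Finset (Finset Lit) :=
  (Finset.Icc 1 (n - 1)).image (fun i => ({(i, false), (i + 1, true)} : Finset Lit))

def famU2 (n : ℕ) : Finset (Finset Lit) :=
  Mn n ∪ {({((1 : ℕ), true)} : Finset Lit), ({((n : ℕ), false)} : Finset Lit)}

def famU1 (n i : ℕ) : Finset (Finset Lit) :=
  Mn n ∪ {({((1 : ℕ), true)} : Finset Lit), ({((n : ℕ), false), ((i : ℕ), false)} : Finset Lit)}

def famU0s (n i : ℕ) : Finset (Finset Lit) :=
  Mn n ∪ {({((1 : ℕ), true), ((i : ℕ), true)} : Finset Lit),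
          ({((n : ℕ), false), ((i : ℕ), false)} : Finset Lit)}

def famU0 (n x y : ℕ) : Finset (Finset Lit) :=
  Mn n ∪ {({((1 : ℕ), true), ((x : ℕ), true)} : Finset Lit),
          ({((n : ℕ), false), ((y : ℕ), false)} : Finset Lit)}

/-- Membership in one of the four families (with the stated parameter ranges). -/
def InFam (G : Finset (Finset Lit)) : Prop :=
  (∃ n, 1 ≤ n ∧ G = famU2 n) ∨
  (∃ n i, 2 ≤ n ∧ 1 ≤ i ∧ i ≤ n - 1 ∧ G = famU1 n i) ∨
  (∃ n i, 3 ≤ n ∧ 2 ≤ i ∧ 2 * i ≤ n + 1 ∧ G = famU0s n i) ∨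
  (∃ n x y, 4 ≤ n ∧ 2 ≤ x ∧ x < y ∧ y ≤ n - 1 ∧ x + y ≤ n + 1 ∧ G = famU0 n x y)

/-- The number of unit-clauses of `F`. -/
def unitCount (F : Finset (Finset Lit)) : ℕ := (F.filter (fun C => C.card = 1)).card

/-- MU 2-clause-sets of deficiency `k` with exactly `n` variables. -/
def MU2dn (k : ℤ) (n : ℕ) : Type :=
  {F : Finset (Finset Lit) // MU2 F ∧ deficiency F = k ∧ (varsOf F).card = n}

/-- Isomorphism relation on `MU2dn k n`. -/
def isoRel {k : ℤ} {n : ℕ} (F F' : MU2dn k n) : Prop := ∃ f, CNFIso F.1 F'.1 f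

/-- The number of isomorphism classes of MU 2-clause-sets of deficiency `k`
with exactly `n` variables. -/
noncomputable def numClasses (k : ℤ) (n : ℕ) : ℕ := Nat.card (Quot (@isoRel k n))

/-- Equivalence of binary bracelets of length `m`: rotations and reflections of the
cyclic index set. -/
def BraceletRel (m : ℕ) (b b' : ZMod m → Bool) : Prop :=
  ∃ (r : ZMod m) (s : Bool), ∀ i, b' i = b (if s then r - i else i + r)

/-- Digraph-isomorphism relation on nonlinear `m`-WDCs. -/
def NonlinWDCRel (m : ℕ) (G G' : {G : FinDigraph ℕ // IsWDC m G ∧ G.Nonlinear}) : Prop :=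
  ∃ f : ℕ → ℕ, DigraphIso G.1 G'.1 f

/-- `H` is a subdigraph of `G`. -/
def Subdigraph {α : Type} (H G : FinDigraph α) : Prop := H.V ⊆ G.V ∧ H.E ⊆ G.E

/-- `E` contains a literal made true by `φ`. -/
def ClauseTrue (φ : ℕ → Bool) (E : Finset Lit) : Prop := ∃ y ∈ E, LitVal φ y = true

lemma compl_compl_lit (x : Lit) : x.compl.compl = x := by simp [Lit.compl]

lemma litVal_compl (φ : ℕ → Bool) (x : Lit) : LitVal φ x.compl = !LitVal φ x := by
  rcases x with ⟨a, b⟩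
  cases b <;> simp [LitVal, Lit.compl]

lemma litVal_update_self (φ : ℕ → Bool) (x : Lit) :
    LitVal (Function.update φ x.1 x.2) x = true := by
  rcases x with ⟨a, b⟩
  cases b <;> simp [LitVal]

lemma litVal_update_of_ne (φ : ℕ → Bool) {x y : Lit} (hy : y ≠ x.compl)
    (h : LitVal φ y = true) : LitVal (Function.update φ x.1 x.2) y = true := by
  rcases x with ⟨a, b⟩
  rcases y with ⟨c, d⟩
  by_cases hca : c = a
  · subst hca
    have : d = b := by
      cases b <;> cases d <;> simp_all [Lit.compl]
    subst this
    exact litVal_update_self φ (c, d)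
  · simpa [LitVal, Function.update_of_ne hca] using h

/-- The resolvent of `C` and `D` on the literal `x` (`x ∈ C`, `x.compl ∈ D`). -/
def clauseResolvent (x : Lit) (C D : Finset Lit) : Finset Lit := C.erase x ∪ D.erase x.compl

/-- The effect of singular DP-reduction on the clauses other than the main clause `C`. -/
def resolveWith (x : Lit) (C D : Finset Lit) : Finset Lit :=
  if x.compl ∈ D then clauseResolvent x C D else D

lemma mem_clauseResolvent {x y : Lit} {C D : Finset Lit} :
    y ∈ clauseResolvent x C D ↔ (y ≠ x ∧ y ∈ C) ∨ (y ≠ x.compl ∧ y ∈ D) := by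
  simp [clauseResolvent]

lemma mem_DP (x : Lit) (F : Finset (Finset Lit)) (E : Finset Lit) :
    E ∈ DP x.1 F ↔ (E ∈ F ∧ x ∉ E ∧ x.compl ∉ E) ∨
      ((∃ C ∈ F, x ∈ C ∧ ∃ D ∈ F, x.compl ∈ D ∧ clauseResolvent x C D = E) ∧ IsClause E) := by
  rcases x with ⟨a, b⟩
  cases b
  · simp only [DP, clauseResolvent, IsClause, Lit.compl, Finset.mem_union, Finset.mem_filter,
      Finset.mem_image, Finset.mem_product, Prod.exists, Bool.not_false]
    constructor
    · rintro (⟨h, h1, h2⟩ | ⟨⟨D, C, ⟨⟨hD, hxD⟩, hC, hxC⟩, rfl⟩, h⟩)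
      · exact .inl ⟨h, h2, h1⟩
      · exact .inr ⟨⟨C, hC, hxC, D, hD, hxD, Finset.union_comm _ _⟩, h⟩
    · rintro (⟨h, h1, h2⟩ | ⟨⟨C, hC, hxC, D, hD, hxD, rfl⟩, h⟩)
      · exact .inl ⟨h, h2, h1⟩
      · exact .inr ⟨⟨D, C, ⟨⟨hD, hxD⟩, hC, hxC⟩, Finset.union_comm _ _⟩, h⟩
  · simp only [DP, clauseResolvent, IsClause, Lit.compl, Finset.mem_union, Finset.mem_filter,
      Finset.mem_image, Finset.mem_product, Prod.exists, Bool.not_true]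
    constructor
    · rintro (h | ⟨⟨C, D, ⟨⟨hC, hxC⟩, hD, hxD⟩, rfl⟩, h⟩)
      · exact .inl h
      · exact .inr ⟨⟨C, hC, hxC, D, hD, hxD, rfl⟩, h⟩
    · rintro (h | ⟨⟨C, hC, hxC, D, hD, hxD, rfl⟩, h⟩)
      · exact .inl h
      · exact .inr ⟨⟨C, D, ⟨⟨hC, hxC⟩, hD, hxD⟩, rfl⟩, h⟩

lemma clauseTrue_clauseResolvent {φ : ℕ → Bool} {x : Lit} {C D : Finset Lit}
    (hC : ClauseTrue φ C) (hD : ClauseTrue φ D) : ClauseTrue φ (clauseResolvent x C D) := by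
  obtain ⟨y, hy, hyt⟩ := hC
  obtain ⟨z, hz, hzt⟩ := hD
  by_cases hyx : y = x
  · subst hyx
    refine ⟨z, mem_clauseResolvent.2 (.inr ⟨?_, hz⟩), hzt⟩
    rintro rfl
    simp [litVal_compl, hyt] at hzt
  · exact ⟨y, mem_clauseResolvent.2 (.inl ⟨hyx, hy⟩), hyt⟩

lemma MU.exists_sat_erase {F : Finset (Finset Lit)} (hF : MU F) {D : Finset Lit} (hD : D ∈ F) :
    ∃ φ, (∀ E ∈ F, E ≠ D → ClauseTrue φ E) ∧ ∀ y ∈ D, LitVal φ y = false := by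
  obtain ⟨φ, hφ⟩ := hF.2.2 _ (Finset.erase_ssubset hD)
  have hE : ∀ E ∈ F, E ≠ D → ClauseTrue φ E := fun E h hne =>
    hφ E (Finset.mem_erase.2 ⟨hne, h⟩)
  refine ⟨φ, hE, fun y hy => ?_⟩
  by_contra hyt
  refine hF.2.1 ⟨φ, fun E h => ?_⟩
  by_cases hED : E = D
  · exact ⟨y, hED ▸ hy, by simpa using hyt⟩
  · exact hE E h hED

/-- In a minimally unsatisfiable clause-set no literal is pure. -/
lemma MU.exists_compl_mem {F : Finset (Finset Lit)} (hF : MU F) {C : Finset Lit} (hC : C ∈ F)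
    {y : Lit} (hy : y ∈ C) : ∃ D ∈ F, y.compl ∈ D := by
  by_contra! hno
  obtain ⟨φ, hφ, -⟩ := hF.exists_sat_erase hC
  refine hF.2.1 ⟨Function.update φ y.1 y.2, fun E h => ?_⟩
  by_cases hEC : E = C
  · exact ⟨y, hEC ▸ hy, litVal_update_self φ y⟩
  · obtain ⟨z, hz, hzt⟩ := hφ E h hEC
    exact ⟨z, hz, litVal_update_of_ne φ (fun hzy => hno E h (hzy ▸ hz)) hzt⟩

/-- If `C` is the only clause containing `x`, then an assignment satisfying all clauses of `F`
except for a clause `D` containing the complement of `x` falsifies both `D` and the resolvent of `C` and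
`D`. -/
lemma MU.exists_falsify_clauseResolvent {F : Finset (Finset Lit)} (hF : MU F) {x : Lit}
    {C : Finset Lit} (hx : ∀ E ∈ F, x ∈ E → E = C) {D : Finset Lit} (hD : D ∈ F)
    (hxD : x.compl ∈ D) :
    ∃ φ, (∀ E ∈ F, E ≠ D → ClauseTrue φ E) ∧ (∀ y ∈ D, LitVal φ y = false) ∧
      ∀ y ∈ clauseResolvent x C D, LitVal φ y = false := by
  obtain ⟨φ, hφ, hfD⟩ := hF.exists_sat_erase hD
  refine ⟨φ, hφ, hfD, fun y hy => ?_⟩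
  rcases mem_clauseResolvent.1 hy with ⟨hyx, hyC⟩ | ⟨-, hyD⟩
  swap
  · exact hfD y hyD
  by_contra hyt
  have hkeep : ∀ z, z ≠ x → LitVal φ z = true →
      LitVal (Function.update φ x.compl.1 x.compl.2) z = true := fun z hz hzt =>
    litVal_update_of_ne φ (by rwa [compl_compl_lit]) hzt
  refine hF.2.1 ⟨Function.update φ x.compl.1 x.compl.2, fun E h => ?_⟩
  by_cases hED : E = D
  · exact ⟨x.compl, hED ▸ hxD, litVal_update_self φ x.compl⟩
  by_cases hxE : x ∈ E
  · exact ⟨y, hx E h hxE ▸ hyC, hkeep y hyx (by simpa using hyt)⟩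
  · obtain ⟨z, hz, hzt⟩ := hφ E h hED
    exact ⟨z, hz, hkeep z (fun hzx => hxE (hzx ▸ hz)) hzt⟩

lemma MU.isClause_clauseResolvent {F : Finset (Finset Lit)} (hF : MU F) {x : Lit}
    {C : Finset Lit} (hx : ∀ E ∈ F, x ∈ E → E = C) {D : Finset Lit} (hD : D ∈ F)
    (hxD : x.compl ∈ D) : IsClause (clauseResolvent x C D) := by
  obtain ⟨φ, -, -, hf⟩ := hF.exists_falsify_clauseResolvent hx hD hxD
  intro y hy hy'
  have := hf _ hy'
  simp [litVal_compl, hf _ hy] at this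

lemma MU.DP_eq_image {F : Finset (Finset Lit)} (hF : MU F) {x : Lit} {C : Finset Lit}
    (hC : C ∈ F) (hxC : x ∈ C) (hx : ∀ E ∈ F, x ∈ E → E = C) :
    DP x.1 F = (F.erase C).image (resolveWith x C) := by
  ext E
  rw [mem_DP]
  simp only [Finset.mem_image, Finset.mem_erase, resolveWith]
  constructor
  · rintro (⟨hE, hxE, hxE'⟩ | ⟨⟨B, hB, hxB, D, hD, hxD, rfl⟩, -⟩)
    · exact ⟨E, ⟨fun h => hxE (h ▸ hxC), hE⟩, by rw [if_neg hxE']⟩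
    · obtain rfl := hx B hB hxB
      exact ⟨D, ⟨fun h => hF.1 B hC x hxC (h ▸ hxD), hD⟩, by rw [if_pos hxD]⟩
  · rintro ⟨D, ⟨hne, hD⟩, rfl⟩
    split_ifs with hxD
    · exact .inr ⟨⟨C, hC, hxC, D, hD, hxD, rfl⟩, hF.isClause_clauseResolvent hx hD hxD⟩
    · exact .inl ⟨hD, fun h => hne (hx D hD h), hxD⟩

lemma mem_resolveWith_of_mem {x z : Lit} {C D : Finset Lit} (hzx : z ≠ x.compl) (hz : z ∈ D) :
    z ∈ resolveWith x C D := by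
  unfold resolveWith
  split_ifs
  · exact mem_clauseResolvent.2 (.inr ⟨hzx, hz⟩)
  · exact hz

lemma clauseTrue_resolveWith {φ : ℕ → Bool} {x : Lit} {C D : Finset Lit}
    (hC : ClauseTrue φ C) (hD : ClauseTrue φ D) : ClauseTrue φ (resolveWith x C D) := by
  unfold resolveWith
  split_ifs
  · exact clauseTrue_clauseResolvent hC hD
  · exact hD

lemma MU.resolveWith_injOn {F : Finset (Finset Lit)} (hF : MU F) {x : Lit} {C : Finset Lit}
    (hx : ∀ E ∈ F, x ∈ E → E = C) :
    Set.InjOn (resolveWith x C) (F.erase C : Finset (Finset Lit)) := by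
  have key : ∀ D ∈ F, ∀ E ∈ F, x.compl ∈ D → resolveWith x C D = resolveWith x C E → D = E := by
    intro D hD E hE hxD h
    by_contra hne
    obtain ⟨φ, hφ, hfD, hf⟩ := hF.exists_falsify_clauseResolvent hx hD hxD
    obtain ⟨z, hz, hzt⟩ := hφ E hE (Ne.symm hne)
    have hzx : z ≠ x.compl := by
      rintro rfl
      simp [hfD _ hxD] at hzt
    have hzR : z ∈ resolveWith x C E := mem_resolveWith_of_mem hzx hz
    rw [← h, resolveWith, if_pos hxD] at hzR
    simp [hf z hzR] at hzt
  intro D hD E hE h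
  simp only [Finset.coe_erase, Set.mem_sdiff, Finset.mem_coe, Set.mem_singleton_iff] at hD hE
  by_cases hxD : x.compl ∈ D
  · exact key D hD.1 E hE.1 hxD h
  by_cases hxE : x.compl ∈ E
  · exact (key E hE.1 D hD.1 hxE h.symm).symm
  · simpa [resolveWith, hxD, hxE] using h

lemma MU.DP_of_unique {F : Finset (Finset Lit)} (hF : MU F) {x : Lit} {C : Finset Lit}
    (hC : C ∈ F) (hxC : x ∈ C) (hx : ∀ E ∈ F, x ∈ E → E = C) : MU (DP x.1 F) := by
  have himg := hF.DP_eq_image hC hxC hx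
  refine ⟨?_, ?_, ?_⟩
  · intro E hE
    rcases (mem_DP x F E).1 hE with ⟨h, -⟩ | ⟨-, h⟩
    · exact hF.1 E h
    · exact h
  · rintro ⟨φ, hφ⟩
    have hφ' : ∀ D ∈ F, D ≠ C → ClauseTrue φ (resolveWith x C D) := fun D hD hne =>
      hφ _ (himg ▸ Finset.mem_image_of_mem _ (Finset.mem_erase.2 ⟨hne, hD⟩))
    by_cases hCt : ∃ y ∈ C, y ≠ x ∧ LitVal φ y = true
    · obtain ⟨y, hyC, hyx, hyt⟩ := hCt
      have hkeep : ∀ z, z ≠ x → LitVal φ z = true →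
          LitVal (Function.update φ x.compl.1 x.compl.2) z = true := fun z hz hzt =>
        litVal_update_of_ne φ (by rwa [compl_compl_lit]) hzt
      refine hF.2.1 ⟨Function.update φ x.compl.1 x.compl.2, fun D hD => ?_⟩
      by_cases hDC : D = C
      · exact ⟨y, hDC ▸ hyC, hkeep y hyx hyt⟩
      by_cases hxD : x.compl ∈ D
      · exact ⟨x.compl, hxD, litVal_update_self φ x.compl⟩
      obtain ⟨z, hz, hzt⟩ := hφ' D hD hDC
      rw [resolveWith, if_neg hxD] at hz
      exact ⟨z, hz, hkeep z (fun h => hDC (hx D hD (h ▸ hz))) hzt⟩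
    · push Not at hCt
      refine hF.2.1 ⟨Function.update φ x.1 x.2, fun D hD => ?_⟩
      by_cases hDC : D = C
      · exact ⟨x, hDC ▸ hxC, litVal_update_self φ x⟩
      obtain ⟨z, hz, hzt⟩ := hφ' D hD hDC
      by_cases hxD : x.compl ∈ D
      · rw [resolveWith, if_pos hxD] at hz
        rcases mem_clauseResolvent.1 hz with ⟨hzx, hzC⟩ | ⟨hzx, hzD⟩
        · exact absurd hzt (hCt z hzC hzx)
        · exact ⟨z, hzD, litVal_update_of_ne φ hzx hzt⟩
      · rw [resolveWith, if_neg hxD] at hz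
        exact ⟨z, hz, litVal_update_of_ne φ (fun h => hxD (h ▸ hz)) hzt⟩
  · intro G hG
    obtain ⟨E, hE, hEG⟩ := Finset.exists_of_ssubset hG
    obtain ⟨D, hD, rfl⟩ := Finset.mem_image.1 (himg ▸ hE)
    obtain ⟨hDC, hDF⟩ := Finset.mem_erase.1 hD
    obtain ⟨φ, hφ, -⟩ := hF.exists_sat_erase hDF
    refine ⟨φ, fun B hB => ?_⟩
    obtain ⟨A, hA, rfl⟩ := Finset.mem_image.1 (himg ▸ hG.1 hB)
    refine clauseTrue_resolveWith (hφ C hC (Ne.symm hDC)) (hφ A (Finset.mem_erase.1 hA).2 ?_)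
    rintro rfl
    exact hEG hB

lemma MU.ldeg_DP {F : Finset (Finset Lit)} (hF : MU F) {x : Lit} {C : Finset Lit}
    (hC : C ∈ F) (hxC : x ∈ C) (hx : ∀ E ∈ F, x ∈ E → E = C) (y : Lit) :
    ldeg (DP x.1 F) y = ((F.erase C).filter (fun D => y ∈ resolveWith x C D)).card := by
  rw [ldeg, hF.DP_eq_image hC hxC hx, Finset.filter_image, Finset.card_image_of_injOn]
  exact (hF.resolveWith_injOn hx).mono (Finset.coe_subset.2 (Finset.filter_subset _ _))

lemma vdeg_eq_ldeg_add (F : Finset (Finset Lit)) (y : Lit) :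
    vdeg F y.1 = ldeg F y + ldeg F y.compl := by
  rcases y with ⟨a, b⟩
  cases b <;> simp [vdeg, Lit.compl, add_comm]

lemma mem_varsOf {F : Finset (Finset Lit)} {y : Lit} {D : Finset Lit} (hD : D ∈ F) (hy : y ∈ D) :
    y.1 ∈ varsOf F :=
  Finset.mem_biUnion.2 ⟨D, hD, Finset.mem_image_of_mem _ hy⟩

lemma eq_or_eq_compl {x y : Lit} (h : y.1 = x.1) : y = x ∨ y = x.compl := by
  rcases x with ⟨a, b⟩
  rcases y with ⟨c, d⟩
  cases b <;> cases d <;> simp_all [Lit.compl]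

lemma MU.three_le_vdeg_DP {F : Finset (Finset Lit)} (hF : MU F)
    (hdeg : ∀ v ∈ varsOf F, 3 ≤ vdeg F v) {x : Lit} (hx1 : ldeg F x = 1) {C : Finset Lit}
    (hC : C ∈ F) (hxC : x ∈ C) (hx : ∀ E ∈ F, x ∈ E → E = C) {w : ℕ}
    (hw : w ∈ varsOf (DP x.1 F)) : 3 ≤ vdeg (DP x.1 F) w := by
  have hcC : x.compl ∉ C := hF.1 C hC x hxC
  have hdx := hdeg _ (mem_varsOf hC hxC)
  rw [vdeg_eq_ldeg_add, hx1] at hdx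
  obtain ⟨E, hE, hwE⟩ := Finset.mem_biUnion.1 hw
  obtain ⟨u, huE, rfl⟩ := Finset.mem_image.1 hwE
  obtain ⟨D, hD, rfl⟩ := Finset.mem_image.1 (hF.DP_eq_image hC hxC hx ▸ hE)
  obtain ⟨hDC, hDF⟩ := Finset.mem_erase.1 hD
  have hu : u ≠ x ∧ u ≠ x.compl ∧ (u ∈ C ∨ u ∈ D) := by
    have hxD : x ∉ D := fun h => hDC (hx D hDF h)
    rw [resolveWith] at huE
    split_ifs at huE with h
    · rcases mem_clauseResolvent.1 huE with ⟨h1, h2⟩ | ⟨h1, h2⟩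
      · exact ⟨h1, fun h => hcC (h ▸ h2), .inl h2⟩
      · exact ⟨fun h => hxD (h ▸ h2), h1, .inr h2⟩
    · exact ⟨fun h' => hxD (h' ▸ huE), fun h' => h (h' ▸ huE), .inr huE⟩
  have hux : u.1 ≠ x.1 := fun h => (eq_or_eq_compl h).elim hu.1 hu.2.1
  by_cases hCu : ∃ y ∈ C, y.1 = u.1
  · obtain ⟨y, hyC, hyu⟩ := hCu
    have hyx : y ≠ x := by
      rintro rfl
      exact hux hyu.symm
    have hyx' : y ≠ x.compl := fun h => hcC (h ▸ hyC)
    rw [← hyu, vdeg_eq_ldeg_add]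
    have h1 : ldeg F x.compl ≤ ldeg (DP x.1 F) y := by
      rw [hF.ldeg_DP hC hxC hx, ldeg]
      refine Finset.card_le_card fun B hB => ?_
      obtain ⟨hBF, hxB⟩ := Finset.mem_filter.1 hB
      refine Finset.mem_filter.2 ⟨Finset.mem_erase.2 ⟨fun h => hcC (h ▸ hxB), hBF⟩, ?_⟩
      rw [resolveWith, if_pos hxB]
      exact mem_clauseResolvent.2 (.inl ⟨hyx, hyC⟩)
    have h2 : 0 < ldeg (DP x.1 F) y.compl := by
      obtain ⟨B, hBF, hyB⟩ := hF.exists_compl_mem hC hyC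
      rw [hF.ldeg_DP hC hxC hx, Finset.card_pos]
      refine ⟨B, Finset.mem_filter.2 ⟨Finset.mem_erase.2 ⟨?_, hBF⟩, ?_⟩⟩
      · rintro rfl
        exact hF.1 _ hC y hyC hyB
      · refine mem_resolveWith_of_mem (fun h => hyx ?_) hyB
        rw [← compl_compl_lit y, h, compl_compl_lit]
    omega
  · push Not at hCu
    have hsame : ∀ y : Lit, y.1 = u.1 → ldeg (DP x.1 F) y = ldeg F y := by
      intro y hy
      have hyC : y ∉ C := fun h => hCu y h hy
      have hyx' : y ≠ x.compl := by
        rintro rfl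
        exact hux hy.symm
      rw [hF.ldeg_DP hC hxC hx, ldeg]
      congr 1
      ext B
      simp only [Finset.mem_filter, Finset.mem_erase]
      constructor
      · rintro ⟨⟨-, hB⟩, hyB⟩
        refine ⟨hB, ?_⟩
        rw [resolveWith] at hyB
        split_ifs at hyB
        · exact (mem_clauseResolvent.1 hyB).elim (fun h => absurd h.2 hyC) (fun h => h.2)
        · exact hyB
      · rintro ⟨hB, hyB⟩
        exact ⟨⟨fun h => hyC (h ▸ hyB), hB⟩, mem_resolveWith_of_mem hyx' hyB⟩
    have huD : u ∈ D := hu.2.2.resolve_left fun h => hCu u h rfl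
    rw [vdeg_eq_ldeg_add, hsame u rfl, hsame (Lit.compl u) rfl, ← vdeg_eq_ldeg_add]
    exact hdeg _ (mem_varsOf hDF huD)

theorem stmt7 (F : Finset (Finset Lit)) (hF : MU F)
    (hdeg : ∀ v ∈ varsOf F, 3 ≤ vdeg F v) (v : ℕ) (hv : Singular F v) :
    MU (DP v F) ∧ ∀ w ∈ varsOf (DP v F), 3 ≤ vdeg (DP v F) w := by
  obtain ⟨b, hb⟩ : ∃ b, ldeg F (v, b) = 1 := hv.elim (fun h => ⟨true, h⟩) (fun h => ⟨false, h⟩)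
  generalize hxv : ((v, b) : Lit) = x at hb
  obtain rfl : v = x.1 := congrArg Prod.fst hxv
  obtain ⟨C, hCeq⟩ := Finset.card_eq_one.1 hb
  have hmem : ∀ E, (E ∈ F ∧ x ∈ E) ↔ E = C := fun E => by
    rw [← Finset.mem_singleton, ← hCeq, Finset.mem_filter]
  obtain ⟨hC, hxC⟩ := (hmem C).2 rfl
  have hx : ∀ E ∈ F, x ∈ E → E = C := fun E hE h => (hmem E).1 ⟨hE, h⟩
  exact ⟨hF.DP_of_unique hC hxC hx, fun w hw => hF.three_le_vdeg_DP hdeg hb hC hxC hx hw⟩
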